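/- Let f = f(x,u,t) be continuous, differentiable in x, with ∇_x f continuous, let 1 < p < ∞ and 1 ≤ q < +∞, and suppose that for every R > 0 there exist C_R > 0 and an a.e. nonnegative ω_R ∈ L^p(0,T) with |f(x,u,t)| ≤ C_R|u|^{q/p} + ω_R(t) for a.e. t ∈ [0,T] and all (x,u) with |x| ≤ R. Then for every u ∈ L^q_m(0,T) the Nemytskii operator G_u : L^∞_d(0,T) → L^p_d(0,T), G_u(x) = f(x(·),u(·),·), is Gâteaux differentiable at every point x ∈ L^∞_d(0,T) with derivative G_u'(x)[h] = ∇_x f(x(·),u(·),·) h(·) for all h ∈ L^∞_d(0,T), if and only if for every R > 0 there exist C_R > 0 and an a.e. nonnegative function ω_R ∈ L^p(0,T) such that |∇_x f(x,u,t)| ≤ C_R|u|^{q/p} + ω_R(t) for a.e. t ∈ (0,T) and all (x,u) ∈ ℝ^d×ℝ^m with |x| ≤ R. -/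

import Mathlib

open MeasureTheory Set Filter Topology
open scoped ENNReal NNReal

noncomputable section

/-- `ℝ^n` as a Euclidean space. -/
abbrev Vec (n : ℕ) := EuclideanSpace ℝ (Fin n)

/-- Lebesgue measure restricted to the interval `(0, T]`. -/
noncomputable def muT (T : ℝ) : Measure ℝ := volume.restrict (Set.Ioc 0 T)

/-- A sub-mass of a density on `(0, T]` can be prescribed exactly. -/
theorem exists_measurableSet_setLIntegral_eq {T : ℝ} (hT : 0 < T) {w : ℝ → ℝ≥0}
    (hw : Integrable (fun t => (w t : ℝ)) (muT T)) {ε : ℝ≥0}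
    (hε : (ε : ℝ≥0∞) ≤ ∫⁻ t, w t ∂muT T) :
    ∃ E : Set ℝ, MeasurableSet E ∧ ∫⁻ t in E, w t ∂muT T = ε := by
  have : NullSingletonClass (muT T) := by unfold muT; infer_instance
  have hcont : Continuous fun s => ∫ t in (0 : ℝ)..s, (w t : ℝ) ∂muT T :=
    hw.continuous_primitive 0
  have hmeas : ∀ s : ℝ, 0 ≤ s →
      ∫⁻ t in Set.Ioc 0 s, w t ∂muT T
        = ENNReal.ofReal (∫ t in (0 : ℝ)..s, (w t : ℝ) ∂muT T) := by
    intro s hs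
    rw [intervalIntegral.integral_of_le hs, ofReal_integral_eq_lintegral_ofReal hw.integrableOn
      (Eventually.of_forall fun t => (w t).coe_nonneg)]
    simp
  have hT' : (ε : ℝ) ≤ ∫ t in (0 : ℝ)..T, (w t : ℝ) ∂muT T := by
    have h : ∫⁻ t in Set.Ioc 0 T, w t ∂muT T = ∫⁻ t, w t ∂muT T := by
      simp [muT]
    rw [← h, hmeas T hT.le, ENNReal.le_ofReal_iff_toReal_le (by simp)] at hε
    · simpa using hε
    · exact intervalIntegral.integral_nonneg hT.le fun t _ => (w t).coe_nonneg
  obtain ⟨s, hs, hsε⟩ := intermediate_value_Icc hT.le hcont.continuousOn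
    (show (ε : ℝ) ∈ Set.Icc _ _ from ⟨by simp, hT'⟩)
  refine ⟨Set.Ioc 0 s, measurableSet_Ioc, ?_⟩
  rw [hmeas s hs.1]
  simp only at hsε
  rw [hsε]
  simp

/-- If the supremum of a sequence of functions has infinite integral, then a measurable selection
among finitely many of them has arbitrarily large integral. -/
theorem exists_measurable_selection_lt_lintegral {α : Type*} [MeasurableSpace α] {μ : Measure α}
    {g : ℕ → α → ℝ≥0∞} (hg : ∀ k, Measurable (g k)) (h : ∫⁻ t, ⨆ k, g k t ∂μ = ∞)
    {K : ℝ≥0∞} (hK : K ≠ ∞) :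
    ∃ (N : ℕ) (κ : α → ℕ), Measurable κ ∧ (∀ t, κ t ≤ N) ∧ K < ∫⁻ t, g (κ t) t ∂μ := by
  classical
  have hmeas : ∀ N, Measurable fun t => partialSups (fun k => g k t) N := fun N => by
    simp only [partialSups_eq_biSup]
    exact Measurable.iSup fun k => Measurable.iSup fun _ => hg k
  simp_rw [← fun t => iSup_partialSups_eq fun k => g k t] at h
  rw [lintegral_iSup hmeas fun i j hij t => (partialSups (fun k => g k t)).monotone hij] at h
  obtain ⟨N, hN⟩ := lt_iSup_iff.1 (h ▸ hK.lt_top)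
  have hex : ∀ t, ∃ k, k ≤ N ∧ partialSups (fun k => g k t) N = g k t := fun t => by
    obtain ⟨k, hk, hk'⟩ := exists_partialSups_eq (fun k => g k t) N
    exact ⟨k, hk, hk'⟩
  refine ⟨N, fun t => Nat.find (hex t), measurable_find hex fun k => ?_,
    fun t => (Nat.find_spec (hex t)).1, ?_⟩
  · exact (MeasurableSet.const _).inter (measurableSet_eq_fun (hmeas N) (hg k))
  · exact hN.trans_eq (lintegral_congr fun t => (Nat.find_spec (hex t)).2)

theorem measurable_apply_nat {α β : Type*} [MeasurableSpace α] [MeasurableSpace β]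
    {g : ℕ → α → β} (hg : ∀ k, Measurable (g k)) {κ : α → ℕ} (hκ : Measurable κ) :
    Measurable fun t => g (κ t) t :=
  (measurable_from_prod_countable_right (f := fun z : ℕ × α => g z.1 z.2) hg).comp
    (hκ.prodMk measurable_id)

/-- If the excess of `g` over `C` times the weight has infinite integral, then some selection has
large integral over a set on which its weight is small. -/
theorem exists_selection_concentrated {T : ℝ} (hT : 0 < T) {g : ℕ → ℝ → ℝ≥0∞}
    (hg : ∀ k, Measurable (g k)) (w : ℕ → ℝ≥0) {C ε : ℝ≥0}
    (h : ∫⁻ t, ⨆ k, (g k t - C * w k) ∂muT T = ∞) :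
    ∃ (κ : ℝ → ℕ) (E : Set ℝ), Measurable κ ∧ MeasurableSet E ∧
      ∫⁻ t in E, w (κ t) ∂muT T ≤ ε ∧ (C * ε : ℝ≥0∞) ≤ ∫⁻ t in E, g (κ t) t ∂muT T := by
  have : IsFiniteMeasure (muT T) := by unfold muT; infer_instance
  obtain ⟨N, κ, hκ, hκN, hK⟩ := exists_measurable_selection_lt_lintegral
    (fun k => (hg k).sub_const (C * w k : ℝ≥0∞)) h
    (show (C * ε : ℝ≥0∞) ≠ ∞ from ENNReal.mul_ne_top (by simp) (by simp))
  have hgκ : Measurable fun t => g (κ t) t := measurable_apply_nat hg hκ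
  have hwκ : Measurable fun t => w (κ t) := (measurable_from_nat (f := w)).comp hκ
  set A : Set ℝ := {t | (C * w (κ t) : ℝ≥0∞) < g (κ t) t}
  have hAm : MeasurableSet A := measurableSet_lt (by fun_prop) hgκ
  by_cases hcase : ∫⁻ t in A, w (κ t) ∂muT T ≤ ε
  · refine ⟨κ, A, hκ, hAm, hcase, hK.le.trans ?_⟩
    rw [← lintegral_indicator hAm]
    refine lintegral_mono fun t => ?_
    by_cases ht : t ∈ A
    · simp [ht]
    · rw [tsub_eq_zero_of_le (not_lt.1 ht)]
      exact zero_le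
  · push Not at hcase
    have hint : Integrable (fun t => ((A.indicator (fun t => w (κ t)) t : ℝ≥0) : ℝ)) (muT T) := by
      refine Integrable.of_bound (C := ∑ k ∈ Finset.range (N + 1), (w k : ℝ))
        (hwκ.indicator hAm).coe_nnreal_real.aestronglyMeasurable (Eventually.of_forall fun t => ?_)
      rw [NNReal.norm_eq]
      refine le_trans (NNReal.coe_le_coe.2 (Set.indicator_le_self' (by simp) t)) ?_
      exact Finset.single_le_sum (f := fun k => (w k : ℝ)) (fun k _ => (w k).coe_nonneg)
        (Finset.mem_range.2 (Nat.lt_succ_of_le (hκN t)))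
    have hcoe : ∀ t, ((A.indicator (fun t => w (κ t)) t : ℝ≥0) : ℝ≥0∞)
        = A.indicator (fun t => (w (κ t) : ℝ≥0∞)) t := fun t => by
      by_cases ht : t ∈ A <;> simp [ht]
    obtain ⟨E, hE, hEε⟩ := exists_measurableSet_setLIntegral_eq hT hint
      (by simp_rw [hcoe]; rw [lintegral_indicator hAm]; exact hcase.le)
    simp_rw [hcoe] at hEε
    rw [lintegral_indicator hAm, Measure.restrict_restrict hAm] at hEε
    refine ⟨κ, A ∩ E, hκ, hAm.inter hE, hEε.le, ?_⟩
    rw [← hEε, ← lintegral_const_mul _ (by fun_prop)]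
    exact setLIntegral_mono hgκ fun t ht => ht.1.le

/-- If for every constant `C` the excess of `g` over `C` times the weight has infinite integral,
then some selection has integrable weight but infinite integral. -/
theorem exists_selection_lintegral_eq_top {T : ℝ} (hT : 0 < T) {g : ℕ → ℝ → ℝ≥0∞}
    (hg : ∀ k, Measurable (g k)) (w : ℕ → ℝ≥0)
    (hbdd : ∀ (t : ℝ) (W : ℝ≥0), ∃ M : ℝ≥0, ∀ k, w k ≤ W → g k t ≤ M)
    (h : ∀ C : ℝ≥0, 0 < C → ∫⁻ t, ⨆ k, (g k t - C * w k) ∂muT T = ∞) :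
    ∃ (κ : ℝ → ℕ) (E : Set ℝ), Measurable κ ∧ MeasurableSet E ∧
      ∫⁻ t in E, w (κ t) ∂muT T ≠ ∞ ∧ ∫⁻ t in E, g (κ t) t ∂muT T = ∞ := by
  classical
  have : IsFiniteMeasure (muT T) := by unfold muT; infer_instance
  choose κ E hκ hE hw hgE using fun n : ℕ => exists_selection_concentrated hT hg w
    (C := 4 ^ n) (ε := (1 / 2) ^ n) (h (4 ^ n) (by positivity))
  have hgκ : ∀ n, Measurable fun t => g (κ n t) t := fun n => measurable_apply_nat hg (hκ n)
  have hwκ : ∀ n, Measurable fun t => (w (κ n t) : ℝ≥0∞) := fun n =>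
    (measurable_from_nat (f := fun k => (w k : ℝ≥0∞))).comp (hκ n)
  set G : ℕ → ℝ → ℝ≥0∞ := fun n => (E n).indicator fun t => g (κ n t) t with hG
  set W : ℕ → ℝ → ℝ≥0∞ := fun n => (E n).indicator fun t => (w (κ n t) : ℝ≥0∞) with hW
  have hGm : ∀ n, Measurable (G n) := fun n => (hgκ n).indicator (hE n)
  have hWm : ∀ n, Measurable (W n) := fun n => (hwκ n).indicator (hE n)
  have hWsum : ∫⁻ t, ∑' n, W n t ∂muT T ≠ ∞ := by
    rw [lintegral_tsum fun n => (hWm n).aemeasurable]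
    refine ne_top_of_le_ne_top (b := ∑' n : ℕ, ((1 / 2 : ℝ≥0) ^ n : ℝ≥0∞)) ?_
      (ENNReal.tsum_le_tsum fun n => ?_)
    · simp [ENNReal.tsum_geometric]
    · rw [hW, lintegral_indicator (hE n)]
      exact_mod_cast hw n
  have hS : ∀ᵐ t ∂muT T, ⨆ n, G n t ≠ ∞ := by
    filter_upwards [ae_lt_top (Measurable.tsum hWm) hWsum] with t ht
    obtain ⟨M, hM⟩ := hbdd t (∑' n, W n t).toNNReal
    refine ne_top_of_le_ne_top (b := (M : ℝ≥0∞)) (by simp) (iSup_le fun n => ?_)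
    by_cases htE : t ∈ E n
    · simp only [hG, Set.indicator_of_mem htE]
      refine hM _ ?_
      rw [← ENNReal.coe_le_coe, ENNReal.coe_toNNReal ht.ne]
      refine le_trans ?_ (ENNReal.le_tsum n)
      simp [hW, htE]
    · simp [hG, htE]
  have hSint : ∫⁻ t, ⨆ n, G n t ∂muT T = ∞ := by
    refine ENNReal.eq_top_of_forall_nnreal_le fun r => ?_
    obtain ⟨n, hn⟩ := pow_unbounded_of_one_lt r (one_lt_two : (1 : ℝ≥0) < 2)
    calc (r : ℝ≥0∞) ≤ ((4 ^ n : ℝ≥0) * ((1 / 2) ^ n : ℝ≥0) : ℝ≥0∞) := by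
          rw [← ENNReal.coe_mul, ← mul_pow]
          norm_num
          exact_mod_cast hn.le
      _ ≤ ∫⁻ t in E n, g (κ n t) t ∂muT T := hgE n
      _ = ∫⁻ t, G n t ∂muT T := (lintegral_indicator (hE n) _).symm
      _ ≤ _ := lintegral_mono fun t => le_iSup (fun n => G n t) n
  have hSm : Measurable fun t => ⨆ n, G n t := Measurable.iSup hGm
  have hex : ∀ t, ∃ n, ⨆ n, G n t ≤ G n t + 1 ∨ ⨆ n, G n t = ∞ := fun t => by
    by_cases htop : ⨆ n, G n t = ∞
    · exact ⟨0, Or.inr htop⟩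
    by_contra! hcon
    have h1 : (⨆ n, G n t) + 1 ≤ ⨆ n, G n t := by
      rw [ENNReal.iSup_add]
      exact iSup_le fun n => (hcon n).1.le
    exact absurd h1 (not_le.2 (ENNReal.lt_add_right htop one_ne_zero))
  set ν : ℝ → ℕ := fun t => Nat.find (hex t)
  have hνm : Measurable ν := measurable_find hex fun n =>
    (measurableSet_le hSm ((hGm n).add_const 1)).union (hSm (measurableSet_singleton ∞))
  have hF : MeasurableSet {t | t ∈ E (ν t)} := by
    have : {t | t ∈ E (ν t)} = ⋃ n, ν ⁻¹' {n} ∩ E n := by ext t; simp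
    rw [this]
    exact MeasurableSet.iUnion fun n => (hνm (measurableSet_singleton n)).inter (hE n)
  refine ⟨fun t => κ (ν t) t, {t | t ∈ E (ν t)}, measurable_apply_nat hκ hνm, hF, ?_, ?_⟩
  · refine ne_top_of_le_ne_top hWsum ?_
    rw [← lintegral_indicator hF]
    refine lintegral_mono fun t => le_trans (le_of_eq ?_) (ENNReal.le_tsum (ν t))
    by_cases ht : t ∈ E (ν t) <;> simp [hW, ht]
  · have hGν : ∀ t, {t | t ∈ E (ν t)}.indicator (fun t => g (κ (ν t) t) t) t = G (ν t) t :=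
      fun t => by by_cases ht : t ∈ E (ν t) <;> simp [hG, ht]
    rw [← lintegral_indicator hF]
    simp_rw [hGν]
    by_contra hne
    refine absurd hSint (ne_top_of_le_ne_top (b := ∫⁻ t, (G (ν t) t + 1) ∂muT T) ?_ ?_)
    · rw [lintegral_add_right _ measurable_const]
      exact ENNReal.add_ne_top.2 ⟨hne, by simp⟩
    · refine lintegral_mono_ae ?_
      filter_upwards [hS] with t ht
      exact (Nat.find_spec (hex t)).resolve_right ht

/-- A continuous integrand whose superposition operator maps bounded measurable functions and
`L^q` functions into `L^p` has, along any sequence of points of a cylinder, an integrable excess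
over a multiple of the weight `‖b‖ ^ q`. -/
theorem exists_lintegral_excess_ne_top {d m : ℕ} {T p q R : ℝ} (hT : 0 < T) (hp : 0 < p)
    (hq : 0 < q) {φ : Vec d × Vec m × ℝ → ℝ≥0} (hφ : Continuous φ)
    (H : ∀ (x : ℝ → Vec d) (u : ℝ → Vec m), Measurable x → Measurable u → (∀ t, ‖x t‖ ≤ R) →
      ∫⁻ t, ‖u t‖ₑ ^ q ∂muT T ≠ ∞ → ∫⁻ t, (φ (x t, u t, t) : ℝ≥0∞) ^ p ∂muT T ≠ ∞)
    {a : ℕ → Vec d} (ha : ∀ k, ‖a k‖ ≤ R) (b : ℕ → Vec m) :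
    ∃ C : ℝ≥0, 0 < C ∧ ∫⁻ t, ⨆ k, (((φ (a k, b k, t) ^ p : ℝ≥0) : ℝ≥0∞)
      - C * (‖b k‖₊ ^ q : ℝ≥0)) ∂muT T ≠ ∞ := by
  have hφp : Continuous fun y => φ y ^ p := (NNReal.continuous_rpow_const hp.le).comp hφ
  have hg : ∀ k, Measurable fun t => ((φ (a k, b k, t) ^ p : ℝ≥0) : ℝ≥0∞) := fun k => by
    have : Continuous fun t => φ (a k, b k, t) ^ p :=
      hφp.comp (by fun_prop : Continuous fun t : ℝ => (a k, b k, t))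
    exact this.measurable.coe_nnreal_ennreal
  have hbdd : ∀ (t : ℝ) (W : ℝ≥0), ∃ M : ℝ≥0, ∀ k, ‖b k‖₊ ^ q ≤ W →
      ((φ (a k, b k, t) ^ p : ℝ≥0) : ℝ≥0∞) ≤ M := fun t W => by
    have hK : IsCompact (Metric.closedBall (0 : Vec d) R ×ˢ
        Metric.closedBall (0 : Vec m) ((W : ℝ) ^ q⁻¹) ×ˢ {t}) :=
      (isCompact_closedBall _ _).prod ((isCompact_closedBall _ _).prod isCompact_singleton)
    obtain ⟨M, hM⟩ := hK.bddAbove_image hφp.continuousOn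
    refine ⟨M, fun k hk => ENNReal.coe_le_coe.2 (hM ⟨(a k, b k, t), ⟨?_, ?_, rfl⟩, rfl⟩)⟩
    · simpa using ha k
    · have hk' : ‖b k‖ ^ q ≤ (W : ℝ) := by exact_mod_cast hk
      rw [mem_closedBall_zero_iff]
      exact (Real.le_rpow_inv_iff_of_pos (norm_nonneg _) W.coe_nonneg hq).2 hk'
  by_contra! hcon
  obtain ⟨κ, E, hκ, hE, hw, htop⟩ := exists_selection_lintegral_eq_top hT hg _ hbdd hcon
  refine H (fun t => a (κ t)) (E.indicator fun t => b (κ t))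
    ((measurable_from_nat (f := a)).comp hκ)
    (((measurable_from_nat (f := b)).comp hκ).indicator hE) (fun t => ha (κ t)) ?_ ?_
  · rw [← lintegral_indicator hE] at hw
    convert hw using 3 with t
    by_cases ht : t ∈ E
    · simp [ht, enorm_eq_nnnorm, ENNReal.coe_rpow_of_nonneg, hq.le]
    · simp [ht, hq]
  · refine top_le_iff.1 (htop ▸ ?_)
    rw [← lintegral_indicator hE]
    refine lintegral_mono fun t => ?_
    by_cases ht : t ∈ E
    · simp [ht, ENNReal.coe_rpow_of_nonneg, hp.le]
    · simp [ht]

/-- A bound for the `p`-th power that holds along a dense sequence yields a bound everywhere. -/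
theorem le_growth_of_forall_dense {X V : Type*} [TopologicalSpace X] [NormedAddCommGroup V]
    {p q : ℝ} (hp : 1 ≤ p) (hq : 0 ≤ q) {φ : X × V → ℝ≥0} (hφ : Continuous φ)
    {z : ℕ → X × V} (hz : DenseRange z) {C : ℝ≥0} {Ω : ℝ≥0∞} (hΩ : Ω ≠ ∞)
    (h : ∀ k, ((φ (z k) ^ p : ℝ≥0) : ℝ≥0∞) ≤ C * (‖(z k).2‖₊ ^ q : ℝ≥0) + Ω) (y : X × V) :
    (φ y : ℝ) ≤ (C : ℝ) ^ p⁻¹ * ‖y.2‖ ^ (q / p) + (Ω ^ p⁻¹).toReal := by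
  have hp0 : 0 < p := by linarith
  lift Ω to ℝ≥0 using hΩ
  have hclosed : IsClosed {y : X × V | φ y ^ p ≤ C * ‖y.2‖₊ ^ q + Ω} :=
    isClosed_le ((NNReal.continuous_rpow_const hp0.le).comp hφ)
      ((continuous_const.mul ((NNReal.continuous_rpow_const hq).comp continuous_snd.nnnorm)).add
        continuous_const)
  have hall : φ y ^ p ≤ C * ‖y.2‖₊ ^ q + Ω :=
    hz.induction_on y hclosed fun k => by exact_mod_cast h k
  have key : φ y ≤ C ^ p⁻¹ * ‖y.2‖₊ ^ (q / p) + Ω ^ p⁻¹ := by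
    calc φ y = (φ y ^ p) ^ p⁻¹ := (NNReal.rpow_rpow_inv hp0.ne' _).symm
      _ ≤ (C * ‖y.2‖₊ ^ q + Ω) ^ p⁻¹ := NNReal.rpow_le_rpow hall (by positivity)
      _ ≤ (C * ‖y.2‖₊ ^ q) ^ p⁻¹ + Ω ^ p⁻¹ :=
          NNReal.rpow_add_le_add_rpow _ _ (by positivity) (inv_le_one_of_one_le₀ hp)
      _ = C ^ p⁻¹ * ‖y.2‖₊ ^ (q / p) + Ω ^ p⁻¹ := by
          rw [NNReal.mul_rpow, ← NNReal.rpow_mul, div_eq_mul_inv]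
  rw [← ENNReal.coe_rpow_of_nonneg _ (by positivity : 0 ≤ p⁻¹)]
  exact_mod_cast key

theorem memLp_toReal_rpow_inv {α : Type*} [MeasurableSpace α] {μ : Measure α} {p : ℝ} (hp : 0 < p)
    {Ω : α → ℝ≥0∞} (hΩm : Measurable Ω) (hΩ : ∫⁻ t, Ω t ∂μ ≠ ∞) :
    MemLp (fun t => (Ω t ^ p⁻¹).toReal) (ENNReal.ofReal p) μ := by
  refine ⟨(hΩm.pow_const _).ennreal_toReal.aestronglyMeasurable, ?_⟩
  rw [eLpNorm_lt_top_iff_lintegral_rpow_enorm_lt_top (by simpa using hp) (by simp),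
    ENNReal.toReal_ofReal hp.le]
  refine lt_of_le_of_lt (lintegral_mono fun t => ?_) hΩ.lt_top
  calc ‖(Ω t ^ p⁻¹).toReal‖ₑ ^ p ≤ (Ω t ^ p⁻¹) ^ p := by
        gcongr
        rw [Real.enorm_of_nonneg ENNReal.toReal_nonneg]
        exact ENNReal.ofReal_toReal_le
    _ = Ω t := ENNReal.rpow_inv_rpow hp.ne' _

/-- A continuous integrand whose superposition operator maps bounded measurable functions and
`L^q` functions into `L^p` has growth of order `q / p`, uniformly on balls. -/
theorem exists_growth_of_superposition {d m : ℕ} {T p q R : ℝ} (hT : 0 < T) (hp : 1 ≤ p)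
    (hq : 0 < q) (hR : 0 ≤ R) {φ : Vec d × Vec m × ℝ → ℝ≥0} (hφ : Continuous φ)
    (H : ∀ (x : ℝ → Vec d) (u : ℝ → Vec m), Measurable x → Measurable u → (∀ t, ‖x t‖ ≤ R) →
      ∫⁻ t, ‖u t‖ₑ ^ q ∂muT T ≠ ∞ → ∫⁻ t, (φ (x t, u t, t) : ℝ≥0∞) ^ p ∂muT T ≠ ∞) :
    ∃ C : ℝ, 0 < C ∧ ∃ ω : ℝ → ℝ,
      MemLp ω (ENNReal.ofReal p) (muT T) ∧ (∀ᵐ t ∂(muT T), 0 ≤ ω t) ∧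
      ∀ᵐ t ∂(muT T), ∀ (a : Vec d) (b : Vec m), ‖a‖ ≤ R →
        (φ (a, b, t) : ℝ) ≤ C * ‖b‖ ^ (q / p) + ω t := by
  have hp0 : 0 < p := by linarith
  have : Nonempty (Metric.closedBall (0 : Vec d) R) := ⟨⟨0, by simpa using hR⟩⟩
  obtain ⟨z, hz⟩ := TopologicalSpace.exists_dense_seq (Metric.closedBall (0 : Vec d) R × Vec m)
  obtain ⟨C, hC, hfin⟩ := exists_lintegral_excess_ne_top hT hp0 hq hφ H
    (a := fun k => ((z k).1 : Vec d)) (fun k => mem_closedBall_zero_iff.1 (z k).1.2) (fun k => (z k).2)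
  have hcont : ∀ t, Continuous fun y : Metric.closedBall (0 : Vec d) R × Vec m =>
      φ (y.1, y.2, t) := fun t => hφ.comp (by fun_prop)
  have hΩm : Measurable fun t => ⨆ k, (((φ ((z k).1, (z k).2, t) ^ p : ℝ≥0) : ℝ≥0∞)
      - C * (‖(z k).2‖₊ ^ q : ℝ≥0)) := by
    refine Measurable.iSup fun k => Measurable.sub_const ?_ _
    have : Continuous fun t => φ ((z k).1, (z k).2, t) ^ p :=
      (NNReal.continuous_rpow_const hp0.le).comp (hφ.comp (by fun_prop))
    exact this.measurable.coe_nnreal_ennreal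
  refine ⟨(C : ℝ) ^ p⁻¹, by positivity, _, memLp_toReal_rpow_inv hp0 hΩm hfin,
    Eventually.of_forall fun t => ENNReal.toReal_nonneg, ?_⟩
  filter_upwards [ae_lt_top hΩm hfin] with t ht a b ha
  refine le_growth_of_forall_dense hp hq.le (hcont t) hz ht.ne (fun k => ?_)
    (⟨a, by simpa using ha⟩, b)
  exact tsub_le_iff_left.1 (le_iSup (fun k => ((φ ((z k).1, (z k).2, t) ^ p : ℝ≥0) : ℝ≥0∞)
      - C * (‖(z k).2‖₊ ^ q : ℝ≥0)) k)

/-- A function is in `L^p` as soon as the `L^p` norms of its truncations are bounded. -/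
theorem memLp_of_toReal_eLpNorm_truncation_le {α G : Type*} [MeasurableSpace α] {μ : Measure α}
    [IsFiniteMeasure μ] [NormedAddCommGroup G] {p : ℝ≥0∞} {v : α → G} (hv : StronglyMeasurable v)
    {K : ℝ} (hK : ∀ n : ℕ, (eLpNorm ({t | ‖v t‖ ≤ n}.indicator v) p μ).toReal ≤ K) :
    MemLp v p μ := by
  have hm : ∀ n : ℕ, MeasurableSet {t | ‖v t‖ ≤ n} := fun n =>
    measurableSet_le hv.norm.measurable measurable_const
  have hfin : ∀ n : ℕ, eLpNorm ({t | ‖v t‖ ≤ n}.indicator v) p μ ≠ ∞ := fun n =>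
    (MemLp.of_bound (hv.indicator (hm n)).aestronglyMeasurable (n : ℝ)
      (Eventually.of_forall fun t => by
        by_cases ht : ‖v t‖ ≤ n
        · simp [Set.indicator, ht]
        · simp [Set.indicator, ht])).eLpNorm_ne_top
  refine ⟨hv.aestronglyMeasurable, lt_of_le_of_lt (Lp.eLpNorm_lim_le_liminf_eLpNorm
    (fun n : ℕ => (hv.indicator (hm n)).aestronglyMeasurable) v
    (Eventually.of_forall fun t => ?_)) (lt_of_le_of_lt ?_ (ENNReal.ofReal_lt_top (r := K)))⟩
  · refine tendsto_const_nhds.congr' ?_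
    filter_upwards [eventually_ge_atTop ⌈‖v t‖⌉₊] with n hn
    rw [Set.indicator_of_mem]
    exact Nat.ceil_le.1 hn
  · refine liminf_le_of_frequently_le' (Frequently.of_forall fun n => ?_)
    rw [← ENNReal.ofReal_toReal (hfin n)]
    exact ENNReal.ofReal_le_ofReal (hK n)

theorem norm_le_sum_norm_apply_single {d : ℕ} {G : Type*} [NormedAddCommGroup G] [NormedSpace ℝ G]
    (L : Vec d →L[ℝ] G) : ‖L‖ ≤ ∑ i, ‖L (EuclideanSpace.single i 1)‖ := by
  refine L.opNorm_le_bound (by positivity) fun x => ?_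
  have hx : x = ∑ i, x i • EuclideanSpace.single i (1 : ℝ) := by
    simpa using ((EuclideanSpace.basisFun (Fin d) ℝ).sum_repr x).symm
  calc ‖L x‖ = ‖∑ i, x i • L (EuclideanSpace.single i 1)‖ := by
        conv_lhs => rw [hx]
        simp
    _ ≤ ∑ i, ‖x i • L (EuclideanSpace.single i 1)‖ := norm_sum_le _ _
    _ ≤ ∑ i, ‖L (EuclideanSpace.single i 1)‖ * ‖x‖ := by
        refine Finset.sum_le_sum fun i _ => ?_
        rw [norm_smul, mul_comm]
        gcongr
        exact PiLp.norm_apply_le x i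
    _ = _ := (Finset.sum_mul ..).symm

/-- Extending by constants in time makes an integrand continuous everywhere. -/
theorem continuous_comp_projIcc {d m : ℕ} {X : Type*} [TopologicalSpace X] {T : ℝ} (hT : 0 ≤ T)
    {F : Vec d → Vec m → ℝ → X}
    (hF : ContinuousOn (fun z : Vec d × Vec m × ℝ => F z.1 z.2.1 z.2.2)
      (Set.univ ×ˢ Set.univ ×ˢ Set.Icc 0 T)) :
    Continuous fun z : Vec d × Vec m × ℝ => F z.1 z.2.1 (Set.projIcc 0 T hT z.2.2) :=
  hF.comp_continuous (f := fun z : Vec d × Vec m × ℝ =>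
      (z.1, z.2.1, (Set.projIcc 0 T hT z.2.2 : ℝ)))
    (by fun_prop) fun z => ⟨trivial, trivial, (Set.projIcc 0 T hT z.2.2).2⟩

theorem ae_muT_mem_Icc (T : ℝ) : ∀ᵐ t ∂muT T, t ∈ Set.Icc 0 T := by
  unfold muT
  filter_upwards [ae_restrict_mem measurableSet_Ioc] with t ht using Set.Ioc_subset_Icc_self ht

theorem aestronglyMeasurable_superposition {d m : ℕ} {X : Type*} [TopologicalSpace X]
    [TopologicalSpace.PseudoMetrizableSpace X] {T : ℝ} (hT : 0 ≤ T)
    {F : Vec d → Vec m → ℝ → X}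
    (hF : ContinuousOn (fun z : Vec d × Vec m × ℝ => F z.1 z.2.1 z.2.2)
      (Set.univ ×ˢ Set.univ ×ˢ Set.Icc 0 T))
    {x : ℝ → Vec d} {u : ℝ → Vec m} (hx : AEStronglyMeasurable x (muT T))
    (hu : AEStronglyMeasurable u (muT T)) :
    AEStronglyMeasurable (fun t => F (x t) (u t) t) (muT T) := by
  refine ((continuous_comp_projIcc hT hF).comp_aestronglyMeasurable
    (hx.prodMk (hu.prodMk aestronglyMeasurable_id))).congr ?_
  filter_upwards [ae_muT_mem_Icc T] with t ht
  simp [Set.projIcc_of_mem hT ht]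

/-- If multiplication by `L` is bounded from `L^∞` to `L^p`, in the sense that the norm of every
product that is in `L^p` is controlled, then the operator norm of `L` is in `L^p`. -/
theorem memLp_opNorm_of_bounded_mul {d : ℕ} {G α : Type*} [NormedAddCommGroup G]
    [NormedSpace ℝ G] [MeasurableSpace α] {μ : Measure α} [IsFiniteMeasure μ] {p : ℝ≥0∞}
    {L : α → Vec d →L[ℝ] G} (hL : StronglyMeasurable L) {C : ℝ} (hC : 0 ≤ C)
    (hbd : ∀ h : α → Vec d, MemLp h ⊤ μ →
      (eLpNorm (fun t => L t (h t)) p μ).toReal ≤ C * (eLpNorm h ⊤ μ).toReal) :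
    MemLp L p μ := by
  have hcol : ∀ e : Vec d, MemLp (fun t => L t e) p μ := fun e => by
    have hv : StronglyMeasurable fun t => L t e :=
      (ContinuousLinearMap.apply ℝ G e).continuous.comp_stronglyMeasurable hL
    refine memLp_of_toReal_eLpNorm_truncation_le hv (K := C * ‖e‖) fun n => ?_
    set S : Set α := {t | ‖L t e‖ ≤ n}
    have hSm : MeasurableSet S := measurableSet_le hv.norm.measurable measurable_const
    have hle : ∀ t, ‖S.indicator (fun _ => e) t‖ ≤ ‖e‖ := fun t => norm_indicator_le_norm_self _ t
    have hmem : MemLp (S.indicator fun _ => e) ⊤ μ :=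
      memLp_top_of_bound (stronglyMeasurable_const.indicator hSm).aestronglyMeasurable ‖e‖
        (Eventually.of_forall hle)
    have heq : S.indicator (fun t => L t e) = fun t => L t (S.indicator (fun _ => e) t) := by
      ext1 t
      by_cases ht : t ∈ S <;> simp [ht]
    rw [heq]
    refine (hbd _ hmem).trans ?_
    gcongr
    refine ENNReal.toReal_le_of_le_ofReal (norm_nonneg _) ?_
    exact eLpNormEssSup_le_of_ae_bound (Eventually.of_forall hle)
  refine (memLp_finsetSum (s := Finset.univ) fun i _ =>
    (hcol (EuclideanSpace.single i 1)).norm).mono hL.aestronglyMeasurable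
    (Eventually.of_forall fun t => ?_)
  exact (norm_le_sum_norm_apply_single (L t)).trans (le_abs_self _)

/-- The growth function of a control in `L^q` is in `L^p`. -/
theorem memLp_growth {m : ℕ} {T p q C : ℝ} (hp : 0 < p) (hq : 0 < q) {u : ℝ → Vec m}
    (hu : MemLp u (ENNReal.ofReal q) (muT T)) {ω : ℝ → ℝ}
    (hω : MemLp ω (ENNReal.ofReal p) (muT T)) :
    MemLp (fun t => C * ‖u t‖ ^ (q / p) + ω t) (ENNReal.ofReal p) (muT T) := by
  have h := hu.norm_rpow_div (ENNReal.ofReal (q / p))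
  rw [ENNReal.toReal_ofReal (by positivity), ← ENNReal.ofReal_div_of_pos (by positivity),
    div_div_cancel₀ hq.ne'] at h
  exact (h.const_mul C).add hω

/-- A difference quotient minus the derivative is bounded by twice the product of a bound for the
derivative and the norm of the direction. -/
theorem norm_diffQuotient_sub_le {E G : Type*} [NormedAddCommGroup E] [NormedSpace ℝ E]
    [NormedAddCommGroup G] [NormedSpace ℝ G] {f : E → G} {f' : E → E →L[ℝ] G}
    (hf : ∀ a, HasFDerivAt f (f' a) a) {x h : E} {R B : ℝ} (hx : ‖x‖ + ‖h‖ ≤ R)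
    (hB : ∀ a, ‖a‖ ≤ R → ‖f' a‖ ≤ B) {α : ℝ} (hα : α ∈ Set.Ioo (0 : ℝ) 1) :
    ‖α⁻¹ • (f (x + α • h) - f x) - f' x h‖ ≤ 2 * (B * ‖h‖) := by
  have hxR : ‖x‖ ≤ R := by linarith [norm_nonneg h]
  have hαh : ‖α • h‖ = α * ‖h‖ := by rw [norm_smul, Real.norm_of_nonneg hα.1.le]
  have hxh : ‖x + α • h‖ ≤ R := by
    refine (norm_add_le _ _).trans ?_
    rw [hαh]
    nlinarith [norm_nonneg h, hα.2]
  have hmv : ‖f (x + α • h) - f x‖ ≤ B * ‖(x + α • h) - x‖ :=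
    (convex_closedBall (0 : E) R).norm_image_sub_le_of_norm_hasFDerivWithin_le
      (fun a _ => (hf a).hasFDerivWithinAt) (fun a ha => hB a (by simpa using ha))
      (by simpa using hxR) (by simpa using hxh)
  rw [add_sub_cancel_left, hαh] at hmv
  have h1 : ‖α⁻¹ • (f (x + α • h) - f x)‖ ≤ B * ‖h‖ := by
    rw [norm_smul, norm_inv, Real.norm_of_nonneg hα.1.le, inv_mul_le_iff₀ hα.1]
    linarith
  have h2 : ‖f' x h‖ ≤ B * ‖h‖ := (f' x).le_of_opNorm_le (hB x hxR) h
  linarith [norm_sub_le (α⁻¹ • (f (x + α • h) - f x)) (f' x h)]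

theorem HasFDerivAt.tendsto_diffQuotient_sub {E G : Type*} [NormedAddCommGroup E] [NormedSpace ℝ E]
    [NormedAddCommGroup G] [NormedSpace ℝ G] {f : E → G} {f' : E →L[ℝ] G} {x : E}
    (hf : HasFDerivAt f f' x) (h : E) :
    Tendsto (fun α : ℝ => α⁻¹ • (f (x + α • h) - f x) - f' h) (𝓝[>] 0) (𝓝 0) := by
  have hline : HasDerivAt (fun α : ℝ => f (x + α • h)) (f' h) 0 := by
    have h0 : HasDerivAt (fun α : ℝ => x + α • h) h 0 := by
      simpa using ((hasDerivAt_id (0 : ℝ)).smul_const h).const_add x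
    exact HasFDerivAt.comp_hasDerivAt (0 : ℝ) (by simpa using hf) h0
  have hlim := (hasDerivAt_iff_tendsto_slope_zero.1 hline).mono_left
    (nhdsWithin_mono 0 fun α (hα : α ∈ Set.Ioi 0) => ne_of_gt hα)
  simpa using hlim.sub_const (f' h)

/-- Dominated convergence in `L^p` for real exponents, along a countably generated filter. -/
theorem tendsto_toReal_eLpNorm_of_dominated {α ι G : Type*} [MeasurableSpace α] {μ : Measure α}
    [NormedAddCommGroup G] {l : Filter ι} [l.IsCountablyGenerated] {p : ℝ} (hp : 0 < p)
    {D : ι → α → G} {B : α → ℝ} (hB : MemLp B (ENNReal.ofReal p) μ)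
    (hD : ∀ i, AEStronglyMeasurable (D i) μ) (hle : ∀ᶠ i in l, ∀ᵐ t ∂μ, ‖D i t‖ ≤ B t)
    (hlim : ∀ᵐ t ∂μ, Tendsto (fun i => D i t) l (𝓝 0)) :
    Tendsto (fun i => (eLpNorm (D i) (ENNReal.ofReal p) μ).toReal) l (𝓝 0) := by
  have hp' : ENNReal.ofReal p ≠ 0 := by simpa using hp
  have hint : Tendsto (fun i => ∫⁻ t, ‖D i t‖ₑ ^ p ∂μ) l (𝓝 (∫⁻ _, 0 ∂μ)) := by
    refine tendsto_of_seq_tendsto fun s hs => ?_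
    obtain ⟨N, hN⟩ := (hs.eventually hle).exists_forall_of_atTop
    refine (tendsto_add_atTop_iff_nat N).1
      (tendsto_lintegral_of_dominated_convergence' (fun t => ‖B t‖ₑ ^ p) ?_ ?_ ?_ ?_)
    · exact fun n => (hD _).enorm.pow_const p
    · intro n
      filter_upwards [hN (n + N) (Nat.le_add_left N n)] with t ht
      gcongr
      exact enorm_le_iff_norm_le.2 (ht.trans (le_abs_self _))
    · have := lintegral_rpow_enorm_lt_top_of_eLpNorm_lt_top hp' (by simp) hB.2
      rw [ENNReal.toReal_ofReal hp.le] at this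
      exact this.ne
    · filter_upwards [hlim] with t ht
      have h1 : Tendsto (fun i => ‖D i t‖ₑ) l (𝓝 0) := by simpa using ht.enorm
      have h2 : Tendsto (fun i => ‖D i t‖ₑ ^ p) l (𝓝 0) := by
        simpa [hp] using h1.ennrpow_const p
      exact h2.comp (hs.comp (tendsto_add_atTop_nat N))
  have h2 : Tendsto (fun i => eLpNorm (D i) (ENNReal.ofReal p) μ) l (𝓝 0) := by
    simp_rw [eLpNorm_eq_lintegral_rpow_enorm_toReal hp' ENNReal.ofReal_ne_top,
      ENNReal.toReal_ofReal hp.le]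
    have h3 := hint.ennrpow_const (1 / p)
    simpa [hp] using h3
  exact (ENNReal.tendsto_toReal ENNReal.zero_ne_top).comp h2

theorem ae_norm_le_toReal_eLpNorm_top {α G : Type*} [MeasurableSpace α] {μ : Measure α}
    [NormedAddCommGroup G] {h : α → G} (hh : MemLp h ⊤ μ) :
    ∀ᵐ t ∂μ, ‖h t‖ ≤ (eLpNorm h ⊤ μ).toReal := by
  filter_upwards [ae_le_eLpNormEssSup (f := h) (μ := μ)] with t ht
  rw [← toReal_enorm]
  exact ENNReal.toReal_mono hh.2.ne ht

/-- Under gradient growth, the difference quotients of the superposition operator converge. -/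
theorem tendsto_eLpNorm_diffQuotient_of_growth {d m : ℕ} {T p q : ℝ} (hT : 0 < T) (hp0 : 0 < p)
    (hq0 : 0 < q) {f : Vec d → Vec m → ℝ → Vec d} {fx : Vec d → Vec m → ℝ → (Vec d →L[ℝ] Vec d)}
    (hfc : ContinuousOn (fun z : Vec d × Vec m × ℝ => f z.1 z.2.1 z.2.2)
      (Set.univ ×ˢ Set.univ ×ˢ Set.Icc 0 T))
    (hfx : ∀ (b : Vec m) (t : ℝ), t ∈ Set.Icc 0 T → ∀ a : Vec d,
      HasFDerivAt (fun a' => f a' b t) (fx a b t) a)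
    (hfxc : ContinuousOn (fun z : Vec d × Vec m × ℝ => fx z.1 z.2.1 z.2.2)
      (Set.univ ×ˢ Set.univ ×ˢ Set.Icc 0 T))
    (hgrowth : ∀ R : ℝ, 0 < R → ∃ C : ℝ, 0 < C ∧ ∃ ω : ℝ → ℝ,
      MemLp ω (ENNReal.ofReal p) (muT T) ∧ (∀ᵐ t ∂(muT T), 0 ≤ ω t) ∧
      ∀ᵐ t ∂(muT T), ∀ (a : Vec d) (b : Vec m), ‖a‖ ≤ R →
        ‖fx a b t‖ ≤ C * ‖b‖ ^ (q / p) + ω t)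
    {u : ℝ → Vec m} (hu : MemLp u (ENNReal.ofReal q) (muT T))
    {x : ℝ → Vec d} (hx : MemLp x ⊤ (muT T))
    {h : ℝ → Vec d} (hh : MemLp h ⊤ (muT T)) :
    Tendsto (fun α : ℝ =>
        (eLpNorm (fun t => α⁻¹ • (f (x t + α • h t) (u t) t - f (x t) (u t) t)
          - fx (x t) (u t) t (h t)) (ENNReal.ofReal p) (muT T)).toReal) (𝓝[>] 0) (𝓝 0) := by
  have hfxm : AEStronglyMeasurable (fun t => fx (x t) (u t) t) (muT T) :=
    aestronglyMeasurable_superposition hT.le hfxc hx.1 hu.1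
  obtain ⟨X, hX0, hX⟩ : ∃ X : ℝ, 0 ≤ X ∧ ∀ᵐ t ∂muT T, ‖x t‖ ≤ X :=
    ⟨_, ENNReal.toReal_nonneg, ae_norm_le_toReal_eLpNorm_top hx⟩
  obtain ⟨Y, hY0, hY⟩ : ∃ Y : ℝ, 0 ≤ Y ∧ ∀ᵐ t ∂muT T, ‖h t‖ ≤ Y :=
    ⟨_, ENNReal.toReal_nonneg, ae_norm_le_toReal_eLpNorm_top hh⟩
  obtain ⟨C, hC, ω, hω, hω0, hbound⟩ := hgrowth (X + Y + 1) (by linarith)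
  refine tendsto_toReal_eLpNorm_of_dominated hp0
    (D := fun α t => α⁻¹ • (f (x t + α • h t) (u t) t - f (x t) (u t) t)
      - fx (x t) (u t) t (h t))
    (B := fun t => (2 * Y) * (C * ‖u t‖ ^ (q / p) + ω t))
    ((memLp_growth hp0 hq0 hu hω).const_mul _) (fun α => ?_) ?_ ?_
  · have h1 : AEStronglyMeasurable (fun t => f (x t + α • h t) (u t) t) (muT T) :=
      aestronglyMeasurable_superposition hT.le hfc (hx.1.add (hh.1.const_smul α)) hu.1
    have h2 : AEStronglyMeasurable (fun t => f (x t) (u t) t) (muT T) :=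
      aestronglyMeasurable_superposition hT.le hfc hx.1 hu.1
    have h3 : AEStronglyMeasurable (fun t => fx (x t) (u t) t (h t)) (muT T) :=
      (isBoundedBilinearMap_apply (𝕜 := ℝ) (E := Vec d)
        (F := Vec d)).continuous.comp_aestronglyMeasurable (hfxm.prodMk hh.1)
    exact ((h1.sub h2).const_smul α⁻¹).sub h3
  · filter_upwards [Ioo_mem_nhdsGT (zero_lt_one' ℝ)] with α hα
    filter_upwards [hX, hY, hbound, hω0, ae_muT_mem_Icc T]
      with t hxt hht ht hωt htI
    refine (norm_diffQuotient_sub_le (fun a => hfx (u t) t htI a)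
      (show ‖x t‖ + ‖h t‖ ≤ X + Y + 1 by linarith) (fun a ha => ht a (u t) ha) hα).trans ?_
    have hB0 : 0 ≤ C * ‖u t‖ ^ (q / p) + ω t := by positivity
    nlinarith [mul_le_mul_of_nonneg_left hht hB0]
  · filter_upwards [ae_muT_mem_Icc T] with t htI
    exact (hfx (u t) t htI (x t)).tendsto_diffQuotient_sub (h t)

/-- Under gradient growth, the candidate derivative is bounded from `L^∞` to `L^p`. -/
theorem exists_bound_derivative_of_growth {d m : ℕ} {T p q : ℝ} (hp0 : 0 < p) (hq0 : 0 < q)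
    {fx : Vec d → Vec m → ℝ → (Vec d →L[ℝ] Vec d)}
    (hgrowth : ∀ R : ℝ, 0 < R → ∃ C : ℝ, 0 < C ∧ ∃ ω : ℝ → ℝ,
      MemLp ω (ENNReal.ofReal p) (muT T) ∧ (∀ᵐ t ∂(muT T), 0 ≤ ω t) ∧
      ∀ᵐ t ∂(muT T), ∀ (a : Vec d) (b : Vec m), ‖a‖ ≤ R →
        ‖fx a b t‖ ≤ C * ‖b‖ ^ (q / p) + ω t)
    {u : ℝ → Vec m} (hu : MemLp u (ENNReal.ofReal q) (muT T))
    {x : ℝ → Vec d} (hx : MemLp x ⊤ (muT T)) :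
    ∃ C : ℝ, 0 ≤ C ∧ ∀ h : ℝ → Vec d, MemLp h ⊤ (muT T) →
      (eLpNorm (fun t => fx (x t) (u t) t (h t)) (ENNReal.ofReal p) (muT T)).toReal
        ≤ C * (eLpNorm h ⊤ (muT T)).toReal := by
  obtain ⟨X, hX0, hX⟩ : ∃ X : ℝ, 0 ≤ X ∧ ∀ᵐ t ∂muT T, ‖x t‖ ≤ X :=
    ⟨_, ENNReal.toReal_nonneg, ae_norm_le_toReal_eLpNorm_top hx⟩
  obtain ⟨C, hC, ω, hω, hω0, hbound⟩ := hgrowth (X + 1) (by linarith)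
  have hB := memLp_growth (C := C) hp0 hq0 hu hω
  refine ⟨_, ENNReal.toReal_nonneg (a := eLpNorm (fun t => C * ‖u t‖ ^ (q / p) + ω t)
    (ENNReal.ofReal p) (muT T)), fun h hh => ?_⟩
  rw [mul_comm, ← ENNReal.toReal_ofReal (ENNReal.toReal_nonneg (a := eLpNorm h ⊤ (muT T))),
    ← ENNReal.toReal_mul]
  refine ENNReal.toReal_mono (ENNReal.mul_ne_top ENNReal.ofReal_ne_top hB.2.ne)
    (eLpNorm_le_mul_eLpNorm_of_ae_le_mul ?_ _)
  filter_upwards [hX, ae_norm_le_toReal_eLpNorm_top hh, hbound, hω0]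
    with t hxt hht ht hωt
  have h1 : ‖fx (x t) (u t) t‖ ≤ C * ‖u t‖ ^ (q / p) + ω t := ht _ _ (by linarith)
  have hB0 : 0 ≤ C * ‖u t‖ ^ (q / p) + ω t := by positivity
  rw [Real.norm_of_nonneg hB0]
  calc ‖fx (x t) (u t) t (h t)‖ ≤ ‖fx (x t) (u t) t‖ * ‖h t‖ :=
        (fx (x t) (u t) t).le_opNorm _
    _ ≤ (C * ‖u t‖ ^ (q / p) + ω t) * (eLpNorm h ⊤ (muT T)).toReal := by gcongr
    _ = _ := mul_comm _ _

/-- A superposition operator with bounded derivative has gradient growth. -/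
theorem exists_growth_of_bounded_derivative {d m : ℕ} {T p q : ℝ} (hT : 0 < T) (hp : 1 ≤ p)
    (hq0 : 0 < q) {fx : Vec d → Vec m → ℝ → (Vec d →L[ℝ] Vec d)}
    (hfxc : ContinuousOn (fun z : Vec d × Vec m × ℝ => fx z.1 z.2.1 z.2.2)
      (Set.univ ×ˢ Set.univ ×ˢ Set.Icc 0 T))
    (hG : ∀ u : ℝ → Vec m, MemLp u (ENNReal.ofReal q) (muT T) →
      ∀ x : ℝ → Vec d, MemLp x ⊤ (muT T) →
        ∃ C : ℝ, 0 ≤ C ∧ ∀ h : ℝ → Vec d, MemLp h ⊤ (muT T) →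
          (eLpNorm (fun t => fx (x t) (u t) t (h t)) (ENNReal.ofReal p) (muT T)).toReal
            ≤ C * (eLpNorm h ⊤ (muT T)).toReal) {R : ℝ} (hR : 0 < R) :
    ∃ C : ℝ, 0 < C ∧ ∃ ω : ℝ → ℝ,
      MemLp ω (ENNReal.ofReal p) (muT T) ∧ (∀ᵐ t ∂(muT T), 0 ≤ ω t) ∧
      ∀ᵐ t ∂(muT T), ∀ (a : Vec d) (b : Vec m), ‖a‖ ≤ R →
        ‖fx a b t‖ ≤ C * ‖b‖ ^ (q / p) + ω t := by
  have hp0 : 0 < p := by linarith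
  have : IsFiniteMeasure (muT T) := by unfold muT; infer_instance
  have hqp : ENNReal.ofReal q ≠ 0 := by simpa using hq0
  have hpp : ENNReal.ofReal p ≠ 0 := by simpa using hp0
  have hF := continuous_comp_projIcc hT.le hfxc
  obtain ⟨C, hC, ω, hω, hω0, hbound⟩ := exists_growth_of_superposition hT hp hq0 hR.le
    hF.nnnorm (R := R) fun x u hx hu hxR huq => by
      have humem : MemLp u (ENNReal.ofReal q) (muT T) := by
        refine ⟨hu.aestronglyMeasurable, ?_⟩
        rw [eLpNorm_lt_top_iff_lintegral_rpow_enorm_lt_top hqp ENNReal.ofReal_ne_top,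
          ENNReal.toReal_ofReal hq0.le]
        exact huq.lt_top
      obtain ⟨C, hC, hbd⟩ := (hG u humem x (memLp_top_of_bound hx.aestronglyMeasurable R
        (Eventually.of_forall hxR)))
      have hmem : MemLp (fun t => fx (x t) (u t) (Set.projIcc 0 T hT.le t))
          (ENNReal.ofReal p) (muT T) := by
        refine memLp_opNorm_of_bounded_mul (hF.comp_stronglyMeasurable
          (hx.prodMk (hu.prodMk measurable_id)).stronglyMeasurable) hC fun h hh => ?_
        refine le_of_eq_of_le (congrArg _ (eLpNorm_congr_ae ?_)) (hbd h hh)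
        filter_upwards [ae_muT_mem_Icc T] with t ht
        simp [Set.projIcc_of_mem hT.le ht]
      have := lintegral_rpow_enorm_lt_top_of_eLpNorm_lt_top hpp ENNReal.ofReal_ne_top hmem.2
      rw [ENNReal.toReal_ofReal hp0.le] at this
      exact this.ne
  refine ⟨C, hC, ω, hω, hω0, ?_⟩
  filter_upwards [hbound, ae_muT_mem_Icc T] with t ht htI a b ha
  simpa [Set.projIcc_of_mem hT.le htI] using ht a b ha

/-- Proposition B.4: let `f` be continuous, differentiable in `x` with `∇_x f` continuous,
`1 < p < ∞`, `1 ≤ q < ∞`, and let `f` satisfy the growth condition of order `(q/p, p)`.  Then for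
every `u ∈ L^q_m(0,T)` the Nemytskii operator `G_u : L^∞_d(0,T) → L^p_d(0,T)`,
`G_u(x) = f(x(·),u(·),·)`, is Gâteaux differentiable at every `x ∈ L^∞_d(0,T)` with derivative
`G_u'(x)[h] = ∇_x f(x(·),u(·),·) h(·)` (a bounded linear operator), if and only if `∇_x f`
satisfies the growth condition of order `(q/p, p)`. -/
theorem nemytskii_gateaux_iff_gradient_growth {d m : ℕ} (T : ℝ) (hT : 0 < T)
    (p q : ℝ) (hp : 1 < p) (hq : 1 ≤ q)
    (f : Vec d → Vec m → ℝ → Vec d)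
    (fx : Vec d → Vec m → ℝ → (Vec d →L[ℝ] Vec d))
    (hfc : ContinuousOn (fun z : Vec d × Vec m × ℝ => f z.1 z.2.1 z.2.2)
      (Set.univ ×ˢ Set.univ ×ˢ Set.Icc 0 T))
    (hfx : ∀ (b : Vec m) (t : ℝ), t ∈ Set.Icc 0 T → ∀ a : Vec d,
      HasFDerivAt (fun a' => f a' b t) (fx a b t) a)
    (hfxc : ContinuousOn (fun z : Vec d × Vec m × ℝ => fx z.1 z.2.1 z.2.2)
      (Set.univ ×ˢ Set.univ ×ˢ Set.Icc 0 T))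
    (hfgrowth : ∀ R : ℝ, 0 < R → ∃ C : ℝ, 0 < C ∧ ∃ ω : ℝ → ℝ,
      MemLp ω (ENNReal.ofReal p) (muT T) ∧ (∀ᵐ t ∂(muT T), 0 ≤ ω t) ∧
      ∀ᵐ t ∂(muT T), ∀ (a : Vec d) (b : Vec m), ‖a‖ ≤ R →
        ‖f a b t‖ ≤ C * ‖b‖ ^ (q / p) + ω t) :
    -- Gâteaux differentiability of `G_u` with the natural derivative ...
    (∀ (u : ℝ → Vec m), MemLp u (ENNReal.ofReal q) (muT T) →
      ∀ (x : ℝ → Vec d), MemLp x ⊤ (muT T) →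
        (∀ (h : ℝ → Vec d), MemLp h ⊤ (muT T) →
          Filter.Tendsto (fun α : ℝ =>
              (eLpNorm (fun t => α⁻¹ • (f (x t + α • h t) (u t) t - f (x t) (u t) t)
                  - fx (x t) (u t) t (h t)) (ENNReal.ofReal p) (muT T)).toReal)
            (nhdsWithin (0 : ℝ) (Set.Ioi 0)) (nhds 0)) ∧
        -- ... the derivative being a bounded linear operator on `L^∞`
        (∃ C : ℝ, 0 ≤ C ∧ ∀ (h : ℝ → Vec d), MemLp h ⊤ (muT T) →
          (eLpNorm (fun t => fx (x t) (u t) t (h t)) (ENNReal.ofReal p) (muT T)).toReal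
            ≤ C * (eLpNorm h ⊤ (muT T)).toReal)) ↔
    -- ... iff `∇_x f` satisfies the growth condition of order `(q/p, p)`
    (∀ R : ℝ, 0 < R → ∃ C : ℝ, 0 < C ∧ ∃ ω : ℝ → ℝ,
      MemLp ω (ENNReal.ofReal p) (muT T) ∧ (∀ᵐ t ∂(muT T), 0 ≤ ω t) ∧
      ∀ᵐ t ∂(muT T), ∀ (a : Vec d) (b : Vec m), ‖a‖ ≤ R →
        ‖fx a b t‖ ≤ C * ‖b‖ ^ (q / p) + ω t) := by
  have hp0 : 0 < p := by linarith
  have hq0 : 0 < q := by linarith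
  constructor
  · intro hG R hR
    exact exists_growth_of_bounded_derivative hT hp.le hq0 hfxc (fun u hu x hx => (hG u hu x hx).2)
      hR
  · intro hgrowth u hu x hx
    exact ⟨fun h hh => tendsto_eLpNorm_diffQuotient_of_growth hT hp0 hq0 hfc hfx hfxc hgrowth hu hx
      hh, exists_bound_derivative_of_growth hp0 hq0 hgrowth hu hx⟩
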